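/- Let G be a connected threshold graph on vertex set {0,1,…,n} (n≥1) labeled by reverse degree sequence. Then Ehr_{q,1}(F_G) = Σ_T q^{inv(T)}, where the sum ranges over all spanning trees T of G rooted at vertex 0 and inv(T) is the number of inversions of T. -/

import Mathlib

open Finset Polynomial

namespace ThresholdFlow

/-- A threshold graph on `{0,…,n}` labeled by reverse degree sequence: whenever `i > j` are
adjacent and `i' ≤ i`, `j' ≤ j`, `i' ≠ j'`, then `i'` and `j'` are adjacent. -/
def IsThreshold (n : ℕ) (G : SimpleGraph (Fin (n+1))) : Prop :=
  ∀ i j i' j' : Fin (n+1), j < i → G.Adj i j → i' ≤ i → j' ≤ j → i' ≠ j' → G.Adj i' j'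

/-- An integer `a`-flow on `G`: nonnegative integers on the edges of `G` (oriented from the
larger endpoint `i` to the smaller endpoint `j`, recorded as `f i j`), with net flow `a i`
at every vertex `i ≠ 0`. -/
def IsFlow (n : ℕ) (G : SimpleGraph (Fin (n+1))) (a : Fin (n+1) → ℕ)
    (f : Fin (n+1) → Fin (n+1) → ℕ) : Prop :=
  (∀ i j, f i j ≠ 0 → j < i ∧ G.Adj i j) ∧
  (∀ i : Fin (n+1), i ≠ 0 → ∑ j, f i j = a i + ∑ j, f j i)

/-- The number of positive entries of a flow. -/
def posCount (n : ℕ) (f : Fin (n+1) → Fin (n+1) → ℕ) : ℕ :=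
  (Finset.univ.filter fun pr : Fin (n+1) × Fin (n+1) => 0 < f pr.1 pr.2).card

/-- `[b]_q = 1 + q + ⋯ + q^(b-1)` as a polynomial in `ℤ[q]`. -/
noncomputable def qnat (b : ℕ) : Polynomial ℤ := ∑ k ∈ Finset.range b, X ^ k

/-- `Ehr_{q,1}(F_G(a))`: the sum over integer `a`-flows with exactly `n` positive entries of
`∏_{e : f(e) > 0} [f(e)]_q`. -/
noncomputable def Ehr1 (n : ℕ) (G : SimpleGraph (Fin (n+1))) (a : Fin (n+1) → ℕ) :
    Polynomial ℤ :=
  ∑ᶠ f ∈ {f | IsFlow n G a f ∧ posCount n f = n},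
    ∏ i, ∏ j, if 0 < f i j then qnat (f i j) else 1

/-- `Ehr_{q,0}(F_G(a))`: the sum over all integer `a`-flows of
`(q-1)^(s(f)-n) ∏_{e : f(e) > 0} q^(f(e)-1)`. -/
noncomputable def Ehr0 (n : ℕ) (G : SimpleGraph (Fin (n+1))) (a : Fin (n+1) → ℕ) :
    Polynomial ℤ :=
  ∑ᶠ f ∈ {f | IsFlow n G a f},
    (X - 1) ^ (posCount n f - n) * ∏ i, ∏ j, if 0 < f i j then X ^ (f i j - 1) else 1

/-- `Ehr_{1,1}(F_G(a))`: the sum over integer `a`-flows with exactly `n` positive entries of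
the product of the positive entries. -/
noncomputable def Ehr11 (n : ℕ) (G : SimpleGraph (Fin (n+1))) (a : Fin (n+1) → ℕ) : ℕ :=
  ∑ᶠ f ∈ {f | IsFlow n G a f ∧ posCount n f = n},
    ∏ i, ∏ j, if 0 < f i j then f i j else 1

/-- A spanning tree of `G` rooted at `0`, encoded by its parent function `p`:
`p 0 = 0`, each `i ≠ 0` is adjacent in `G` to its parent `p i`, and iterating the parent
function from any vertex reaches the root `0`. -/
def IsSpanTree (n : ℕ) (G : SimpleGraph (Fin (n+1))) (p : Fin (n+1) → Fin (n+1)) : Prop :=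
  p 0 = 0 ∧ (∀ i, i ≠ 0 → G.Adj i (p i)) ∧ ∀ i, ∃ k, p^[k] i = 0

/-- `j` is a descendant of `i` in the rooted tree with parent function `p`
(in particular every vertex is a descendant of itself). -/
def Desc (n : ℕ) (p : Fin (n+1) → Fin (n+1)) (i j : Fin (n+1)) : Prop :=
  ∃ k, p^[k] j = i

/-- The set of inversions of the rooted tree `p`: pairs `(i,j)` with `i > j`, `i ≠ 0` and
`j` a descendant of `i`. -/
def invSet (n : ℕ) (p : Fin (n+1) → Fin (n+1)) : Set (Fin (n+1) × Fin (n+1)) :=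
  {pr | pr.2 < pr.1 ∧ pr.1 ≠ 0 ∧ Desc n p pr.1 pr.2}

/-- The number of inversions of the rooted tree `p`. -/
noncomputable def treeInv (n : ℕ) (p : Fin (n+1) → Fin (n+1)) : ℕ := (invSet n p).ncard

/-- A rooted spanning tree is increasing if it has no inversions. -/
def IsIncr (n : ℕ) (p : Fin (n+1) → Fin (n+1)) : Prop := invSet n p = ∅

/-- `δ_T(i)`: the number of descendants of `i` (including `i` itself). -/
noncomputable def delta (n : ℕ) (p : Fin (n+1) → Fin (n+1)) (i : Fin (n+1)) : ℕ :=
  Set.ncard {j | Desc n p i j}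

/-- `δ_T^a(i) = Σ_j a_j`, summed over the descendants `j` of `i` (including `i` itself). -/
noncomputable def deltaA (n : ℕ) (a : Fin (n+1) → ℕ) (p : Fin (n+1) → Fin (n+1))
    (i : Fin (n+1)) : ℕ :=
  ∑ᶠ j ∈ {j | Desc n p i j}, a j

/-- The degree `d_i` of vertex `i` in `G`. -/
noncomputable def deg (n : ℕ) (G : SimpleGraph (Fin (n+1))) (i : Fin (n+1)) : ℕ :=
  Set.ncard {j | G.Adj i j}

/-- `d̄_i`: the number of neighbors of `i` smaller than `i`. -/
noncomputable def dbar (n : ℕ) (G : SimpleGraph (Fin (n+1))) (i : Fin (n+1)) : ℕ :=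
  Set.ncard {j | j < i ∧ G.Adj i j}

/-- A `G`-parking function, encoded as `P : Fin (n+1) → ℕ` with `P 0 = 0`. -/
def IsParking (n : ℕ) (G : SimpleGraph (Fin (n+1))) (P : Fin (n+1) → ℕ) : Prop :=
  P 0 = 0 ∧ ∀ S : Finset (Fin (n+1)), S.Nonempty → (0 : Fin (n+1)) ∉ S →
    ∃ i ∈ S, P i < Set.ncard {j | j ∉ S ∧ G.Adj i j}

/-- `codeg(P) = (|E(G)| - n) - Σ_{i=1}^n P(i)`. -/
noncomputable def codeg (n : ℕ) (G : SimpleGraph (Fin (n+1))) (P : Fin (n+1) → ℕ) : ℕ :=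
  (Set.ncard G.edgeSet - n) - ∑ i, P i

/-- `[m]_q` as a Laurent polynomial. -/
noncomputable def lq (m : ℕ) : LaurentPolynomial ℤ :=
  ∑ k ∈ Finset.range m, LaurentPolynomial.T (k : ℤ)

/-- `[b]_{q^m} = 1 + q^m + ⋯ + q^{m(b-1)}` as a Laurent polynomial. -/
noncomputable def lqpow (m b : ℕ) : LaurentPolynomial ℤ :=
  ∑ k ∈ Finset.range b, LaurentPolynomial.T ((m : ℤ) * k)

/-- `wt_{q,q⁻¹}(b)`: the substitution `t = q⁻¹` in `wt_{q,t}(b) = Σ_{k=0}^{b-1} q^k t^{b-1-k}`,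
with `wt_{q,q⁻¹}(0) = 1`. -/
noncomputable def wtqq (b : ℕ) : LaurentPolynomial ℤ :=
  if b = 0 then 1 else ∑ k ∈ Finset.range b, LaurentPolynomial.T (2 * (k : ℤ) - ((b : ℤ) - 1))

/-- `Ehr_{q,q⁻¹}(F_G(a))`: the sum over all integer `a`-flows `f` of
`(-(1-q)(1-q⁻¹))^(s(f)-n) ∏_e wt_{q,q⁻¹}(f(e))`, as a Laurent polynomial in `q`. -/
noncomputable def Ehrqq (n : ℕ) (G : SimpleGraph (Fin (n+1))) (a : Fin (n+1) → ℕ) :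
    LaurentPolynomial ℤ :=
  ∑ᶠ f ∈ {f | IsFlow n G a f},
    (-((1 - LaurentPolynomial.T 1) * (1 - LaurentPolynomial.T (-1)))) ^ (posCount n f - n) *
      ∏ i, ∏ j, wtqq (f i j)

end ThresholdFlow

namespace ThresholdFlow

set_option linter.unusedSectionVars false

section TreeDecomp

variable {V : Type*} [Fintype V] [DecidableEq V] {R : Type*} [CommRing R]

lemma iter_inv (p : V → V) (P : V → Prop) (h : ∀ v, P v → P (p v)) (k : ℕ) :
    ∀ v, P v → P (p^[k] v) := by
  induction k with
  | zero => intro v hv; simpa using hv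
  | succ k ih => intro v hv; rw [Function.iterate_succ_apply]; exact ih _ (h _ hv)

lemma iter_fix (p : V → V) (v : V) (h : p v = v) (k : ℕ) : p^[k] v = v :=
  Function.iterate_fixed h k

lemma reach_congr (p p' : V → V) (t : V) (P : V → Prop)
    (h : ∀ v, P v → v ≠ t → p' v = p v ∧ P (p v)) (k : ℕ) :
    ∀ v, P v → p^[k] v = t → ∃ k', p'^[k'] v = t := by
  induction k with
  | zero => intro v _ hk; exact ⟨0, by simpa using hk⟩
  | succ k ih =>
    intro v hv hk
    by_cases hvt : v = t
    · exact ⟨0, by simpa using hvt⟩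
    · obtain ⟨h1, h2⟩ := h v hv hvt
      rw [Function.iterate_succ_apply] at hk
      obtain ⟨k', hk'⟩ := ih _ h2 hk
      exact ⟨k' + 1, by rw [Function.iterate_succ_apply, h1]; exact hk'⟩

open Classical in
/-- Descendants as a finset. -/
noncomputable def dsc (p : V → V) (i : V) : Finset V :=
  Finset.univ.filter fun j => ∃ k, p^[k] j = i

lemma mem_dsc {p : V → V} {i j : V} : j ∈ dsc p i ↔ ∃ k, p^[k] j = i := by
  simp [dsc]

/-- Parent functions of trees with vertex set `S` and root `r`. -/
def IsTreeOn (S : Finset V) (r : V) (p : V → V) : Prop :=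
  (∀ v, v ∉ S → p v = v) ∧ p r = r ∧ (∀ v ∈ S, p v ∈ S) ∧ ∀ v ∈ S, ∃ k, p^[k] v = r

open Classical in
noncomputable def trees (S : Finset V) (r : V) : Finset (V → V) :=
  Finset.univ.filter (IsTreeOn S r)

lemma mem_trees {S : Finset V} {r : V} {p : V → V} : p ∈ trees S r ↔ IsTreeOn S r p := by
  simp [trees]

/-- Weighted sum over trees on `S` with root `r`. -/
noncomputable def W (φ : V → V → Finset V → R) (S : Finset V) (r : V) : R :=
  ∑ p ∈ trees S r, ∏ i ∈ S.erase r, φ i (p i) (dsc p i)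

def glue (r : V) (B : Finset V) (i : V) (p₁ p₂ : V → V) : V → V := fun v =>
  if v = i then r else if v ∈ B then p₁ v else p₂ v

section glue
variable {S B : Finset V} {r i : V} {p₁ p₂ : V → V}

lemma glue_root : glue r B i p₁ p₂ i = r := by simp [glue]

lemma glue_mem {v : V} (h : v ∈ B) (h' : v ≠ i) : glue r B i p₁ p₂ v = p₁ v := by
  simp [glue, h, h']

lemma glue_not_mem (hi : i ∈ B) {v : V} (h : v ∉ B) : glue r B i p₁ p₂ v = p₂ v := by
  have : v ≠ i := fun h' => h (h' ▸ hi)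
  simp [glue, h, this]

lemma p2_not_mem (h₂ : IsTreeOn (S \ B) r p₂) {v : V} (h : v ∉ B) : p₂ v ∉ B := by
  by_cases hv : v ∈ S
  · have := h₂.2.2.1 v (by simp [hv, h])
    simp at this; exact this.2
  · rw [h₂.1 v (by simp [hv])]; exact h

lemma glue_tree (hr : r ∈ S) (hB : B ⊆ S.erase r) (hi : i ∈ B) (h₁ : IsTreeOn B i p₁)
    (h₂ : IsTreeOn (S \ B) r p₂) : IsTreeOn S r (glue r B i p₁ p₂) := by
  have hBS : B ⊆ S := hB.trans (Finset.erase_subset _ _)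
  have hrB : r ∉ B := fun h => by simpa using hB h
  refine ⟨?_, ?_, ?_, ?_⟩
  · intro v hv
    have : v ∉ B := fun h => hv (hBS h)
    rw [glue_not_mem hi this]
    exact h₂.1 v (by simp [hv])
  · rw [glue_not_mem hi hrB]; exact h₂.2.1
  · intro v hv
    by_cases hvB : v ∈ B
    · by_cases hvi : v = i
      · subst hvi; rw [glue_root]; exact hr
      · rw [glue_mem hvB hvi]; exact hBS (h₁.2.2.1 v hvB)
    · rw [glue_not_mem hi hvB]
      exact (Finset.mem_sdiff.1 (h₂.2.2.1 v (by simp [hv, hvB]))).1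
  · intro v hv
    by_cases hvB : v ∈ B
    · obtain ⟨k, hk⟩ := h₁.2.2.2 v hvB
      obtain ⟨k', hk'⟩ := reach_congr p₁ (glue r B i p₁ p₂) i (· ∈ B)
        (fun w hw hwi => ⟨glue_mem hw hwi, h₁.2.2.1 w hw⟩) k v hvB hk
      exact ⟨k' + 1, by rw [Function.iterate_succ_apply', hk', glue_root]⟩
    · obtain ⟨k, hk⟩ := h₂.2.2.2 v (by simp [hv, hvB])
      exact reach_congr p₂ (glue r B i p₁ p₂) r (· ∉ B)
        (fun w hw _ => ⟨glue_not_mem hi hw, p2_not_mem h₂ hw⟩) k v hvB hk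

lemma glue_not_mem_inv (hi : i ∈ B) (h₂ : IsTreeOn (S \ B) r p₂) (k : ℕ) {v : V} (hv : v ∉ B) :
    (glue r B i p₁ p₂)^[k] v ∉ B :=
  iter_inv _ (· ∉ B) (fun w hw => by rw [glue_not_mem hi hw]; exact p2_not_mem h₂ hw) k v hv

lemma dsc_glue_root (hi : i ∈ B) (h₁ : IsTreeOn B i p₁)
    (h₂ : IsTreeOn (S \ B) r p₂) : dsc (glue r B i p₁ p₂) i = B := by
  ext v
  rw [mem_dsc]
  constructor
  · rintro ⟨k, hk⟩
    by_contra hv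
    have := glue_not_mem_inv (p₁ := p₁) hi h₂ k hv
    rw [hk] at this
    exact this hi
  · intro hvB
    obtain ⟨k, hk⟩ := h₁.2.2.2 v hvB
    exact reach_congr p₁ (glue r B i p₁ p₂) i (· ∈ B)
        (fun w hw hwi => ⟨glue_mem hw hwi, h₁.2.2.1 w hw⟩) k v hvB hk

lemma dsc_glue_mem (hB : B ⊆ S.erase r) (hi : i ∈ B) (h₁ : IsTreeOn B i p₁)
    (h₂ : IsTreeOn (S \ B) r p₂) {v : V} (hv : v ∈ B) (hvi : v ≠ i) :
    dsc (glue r B i p₁ p₂) v = dsc p₁ v := by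
  have hrB : r ∉ B := fun h => by simpa using hB h
  have hpr : glue r B i p₁ p₂ r = r := by rw [glue_not_mem hi hrB]; exact h₂.2.1
  ext j
  rw [mem_dsc, mem_dsc]
  constructor
  · rintro ⟨k, hk⟩
    refine reach_congr (glue r B i p₁ p₂) p₁ v
      (fun w => ∃ k, (glue r B i p₁ p₂)^[k] w = v) ?_ k j ⟨k, hk⟩ hk
    rintro w ⟨l, hl⟩ hwv
    have hwB : w ∈ B := by
      by_contra h
      exact glue_not_mem_inv (p₁ := p₁) hi h₂ l h (hl ▸ hv)
    cases l with
    | zero => exact absurd hl hwv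
    | succ l =>
      rw [Function.iterate_succ_apply] at hl
      have hwi : w ≠ i := by
        rintro rfl
        rw [glue_root, iter_fix _ _ hpr] at hl
        exact hrB (hl ▸ hv)
      exact ⟨(glue_mem hwB hwi).symm, l, hl⟩
  · rintro ⟨k, hk⟩
    refine reach_congr p₁ (glue r B i p₁ p₂) v
      (fun w => ∃ k, p₁^[k] w = v) ?_ k j ⟨k, hk⟩ hk
    rintro w ⟨l, hl⟩ hwv
    have hwB : w ∈ B := by
      by_contra h
      rw [iter_fix _ _ (h₁.1 w h)] at hl
      exact hwv hl
    cases l with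
    | zero => exact absurd hl hwv
    | succ l =>
      have hwi : w ≠ i := by
        rintro rfl
        rw [iter_fix _ _ h₁.2.1] at hl
        exact hwv hl
      rw [Function.iterate_succ_apply] at hl
      exact ⟨glue_mem hwB hwi, l, hl⟩

lemma dsc_glue_not_mem (hB : B ⊆ S.erase r) (hi : i ∈ B) (h₁ : IsTreeOn B i p₁)
    (h₂ : IsTreeOn (S \ B) r p₂) {v : V} (hv : v ∉ B) (hvr : v ≠ r) :
    dsc (glue r B i p₁ p₂) v = dsc p₂ v := by
  have hrB : r ∉ B := fun h => by simpa using hB h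
  have hpr : glue r B i p₁ p₂ r = r := by rw [glue_not_mem hi hrB]; exact h₂.2.1
  ext j
  rw [mem_dsc, mem_dsc]
  constructor
  · rintro ⟨k, hk⟩
    have hj : j ∉ B := by
      intro hj
      have := iter_inv (glue r B i p₁ p₂) (fun w => w ∈ B ∨ w = r) (by
        rintro w (hw | rfl)
        · by_cases hwi : w = i
          · right; rw [hwi, glue_root]
          · left; rw [glue_mem hw hwi]; exact h₁.2.2.1 w hw
        · right; exact hpr) k j (Or.inl hj)
      rw [hk] at this
      exact this.elim hv hvr
    exact reach_congr (glue r B i p₁ p₂) p₂ v (· ∉ B) (fun w hw _ => by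
      rw [glue_not_mem hi hw]; exact ⟨rfl, p2_not_mem h₂ hw⟩) k j hj hk
  · rintro ⟨k, hk⟩
    have hj : j ∉ B := by
      intro hj
      rw [iter_fix _ _ (h₂.1 j (by simp [hj]))] at hk
      exact hv (hk ▸ hj)
    exact reach_congr p₂ (glue r B i p₁ p₂) v (· ∉ B) (fun w hw _ => by
      rw [glue_not_mem hi hw]; exact ⟨rfl, p2_not_mem h₂ hw⟩) k j hj hk

end glue

lemma tree_split {S : Finset V} {r m : V} {p : V → V} (hp : IsTreeOn S r p)
    (hm : m ∈ S) (hmr : m ≠ r) :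
    ∃ B i p₁ p₂, B ⊆ S.erase r ∧ m ∈ B ∧ i ∈ B ∧ IsTreeOn B i p₁ ∧ IsTreeOn (S \ B) r p₂ ∧
      glue r B i p₁ p₂ = p := by
  classical
  have hex := hp.2.2.2 m hm
  obtain ⟨k, hk⟩ : ∃ k, Nat.find hex = k + 1 := by
    rcases h : Nat.find hex with _ | k
    · have := Nat.find_spec hex
      rw [h] at this
      exact absurd this hmr
    · exact ⟨k, rfl⟩
  have hpi : p (p^[k] m) = r := by
    have := Nat.find_spec hex
    rwa [hk, Function.iterate_succ_apply'] at this
  have hir : p^[k] m ≠ r := Nat.find_min hex (by omega)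
  have hmB : m ∈ dsc p (p^[k] m) := mem_dsc.2 ⟨k, rfl⟩
  have hiS : p^[k] m ∈ S := iter_inv p (· ∈ S) hp.2.2.1 k m hm
  generalize p^[k] m = i at *
  have hiB : i ∈ dsc p i := mem_dsc.2 ⟨0, rfl⟩
  have hrB : r ∉ dsc p i := by
    rw [mem_dsc]; rintro ⟨l, hl⟩
    rw [iter_fix _ _ hp.2.1] at hl
    exact hir hl.symm
  have hBS : ∀ v ∈ dsc p i, v ∈ S := by
    intro v hv
    by_contra h
    obtain ⟨l, hl⟩ := mem_dsc.1 hv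
    rw [iter_fix _ _ (hp.1 v h)] at hl
    exact h (hl ▸ hiS)
  have hcl : ∀ v ∈ dsc p i, v ≠ i → p v ∈ dsc p i := by
    intro v hv hvi
    obtain ⟨l, hl⟩ := mem_dsc.1 hv
    cases l with
    | zero => exact absurd hl hvi
    | succ l => rw [Function.iterate_succ_apply] at hl; exact mem_dsc.2 ⟨l, hl⟩
  have hcl2 : ∀ v, v ∉ dsc p i → p v ∉ dsc p i := by
    intro v hv h
    obtain ⟨l, hl⟩ := mem_dsc.1 h
    exact hv (mem_dsc.2 ⟨l + 1, by rw [Function.iterate_succ_apply]; exact hl⟩)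
  refine ⟨dsc p i, i, fun v => if v ∈ dsc p i ∧ v ≠ i then p v else v,
    fun v => if v ∈ dsc p i then v else p v, ?_, hmB, hiB, ?_, ?_, ?_⟩
  · intro v hv
    rw [Finset.mem_erase]
    exact ⟨fun h => hrB (h ▸ hv), hBS v hv⟩
  · refine ⟨fun v hv => by simp [hv], by simp, ?_, ?_⟩
    · intro v hv
      by_cases hvi : v = i
      · simp [hvi, hiB]
      · simp [hv, hvi, hcl v hv hvi]
    · intro v hv
      obtain ⟨l, hl⟩ := mem_dsc.1 hv
      exact reach_congr p _ i (· ∈ dsc p i)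
        (fun w hw hwi => ⟨by simp [hw, hwi], hcl w hw hwi⟩) l v hv hl
  · refine ⟨?_, by simp [hrB, hp.2.1], ?_, ?_⟩
    · intro v hv
      by_cases h : v ∈ dsc p i
      · simp [h]
      · simp only [h, if_false]
        exact hp.1 v (fun h' => hv (by simp [h, h']))
    · intro v hv
      simp only [Finset.mem_sdiff] at hv
      simp [hv.2, hcl2 v hv.2, hp.2.2.1 v hv.1]
    · intro v hv
      simp only [Finset.mem_sdiff] at hv
      obtain ⟨l, hl⟩ := hp.2.2.2 v hv.1
      exact reach_congr p _ r (· ∉ dsc p i)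
        (fun w hw _ => ⟨by simp [hw], hcl2 w hw⟩) l v hv.2 hl
  · funext v
    by_cases hvi : v = i
    · subst hvi; rw [glue_root, hpi]
    · by_cases h : v ∈ dsc p i
      · rw [glue_mem h hvi]; simp [h, hvi]
      · rw [glue_not_mem hiB h]; simp [h]

lemma top_unique {p : V → V} {r m i j : V} (hr : p r = r) (hi : p i = r) (hir : i ≠ r)
    (hj : p j = r) (hjr : j ≠ r) (hmi : m ∈ dsc p i) (hmj : m ∈ dsc p j) : i = j := by
  obtain ⟨k, hk⟩ := mem_dsc.1 hmi
  obtain ⟨l, hl⟩ := mem_dsc.1 hmj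
  have key : ∀ (a b : V) (k l : ℕ), p a = r → b ≠ r → p^[k] m = a → p^[l] m = b → ¬ k < l := by
    intro a b k l ha hb hka hlb hlt
    obtain ⟨d, rfl⟩ := Nat.exists_eq_add_of_lt hlt
    rw [show k + d + 1 = d + (k + 1) by ring, Function.iterate_add_apply,
      Function.iterate_succ_apply', hka, ha, iter_fix _ _ hr] at hlb
    exact hb hlb.symm
  have h1 := key i j k l hi hjr hk hl
  have h2 := key j i l k hj hir hl hk
  have : k = l := by omega
  rw [← hk, ← hl, this]

theorem W_rec (φ : V → V → Finset V → R) (S : Finset V) (r m : V) (hr : r ∈ S) (hm : m ∈ S)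
    (hmr : m ≠ r) :
    W φ S r = ∑ B ∈ (S.erase r).powerset.filter (m ∈ ·),
      ∑ i ∈ B, φ i r B * W φ B i * W φ (S \ B) r := by
  have hexp : ∀ B i, φ i r B * W φ B i * W φ (S \ B) r =
      ∑ q ∈ trees B i ×ˢ trees (S \ B) r, φ i r B *
        (∏ v ∈ B.erase i, φ v (q.1 v) (dsc q.1 v)) *
        (∏ v ∈ (S \ B).erase r, φ v (q.2 v) (dsc q.2 v)) := by
    intro B i
    rw [Finset.sum_product, W, W, mul_assoc, Finset.sum_mul_sum, Finset.mul_sum]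
    refine Finset.sum_congr rfl fun a _ => ?_
    rw [Finset.mul_sum]
    refine Finset.sum_congr rfl fun b _ => ?_
    ring
  simp_rw [hexp]
  rw [Finset.sum_sigma', Finset.sum_sigma', W]
  symm
  refine Finset.sum_bij (fun x _ => glue r x.1.1 x.1.2 x.2.1 x.2.2) ?_ ?_ ?_ ?_
  · rintro ⟨⟨B, i⟩, p₁, p₂⟩ h
    simp only [Finset.mem_sigma, Finset.mem_filter, Finset.mem_powerset, Finset.mem_product,
      mem_trees] at h ⊢
    exact glue_tree hr h.1.1.1 h.1.2 h.2.1 h.2.2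
  · rintro ⟨⟨B, i⟩, p₁, p₂⟩ h ⟨⟨B', i'⟩, p₁', p₂'⟩ h' heq
    simp only [Finset.mem_sigma, Finset.mem_filter, Finset.mem_powerset, Finset.mem_product,
      mem_trees] at h h' heq
    obtain ⟨⟨⟨hB, hmB⟩, hi⟩, h₁, h₂⟩ := h
    obtain ⟨⟨⟨hB', hmB'⟩, hi'⟩, h₁', h₂'⟩ := h'
    have hd := dsc_glue_root hi h₁ h₂
    have hd' := dsc_glue_root hi' h₁' h₂'
    have hri : i ≠ r := (Finset.mem_erase.1 (hB hi)).1
    have hri' : i' ≠ r := (Finset.mem_erase.1 (hB' hi')).1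
    have hii : i = i' := by
      refine top_unique (p := glue r B i p₁ p₂) (m := m)
        (glue_tree hr hB hi h₁ h₂).2.1 glue_root hri ?_ hri' (by rwa [hd]) ?_
      · rw [heq, glue_root]
      · rw [heq, hd']; exact hmB'
    subst hii
    have hBB : B = B' := by rw [← hd, ← hd', heq]
    subst hBB
    have e1 : p₁ = p₁' := by
      funext v
      by_cases hv : v ∈ B
      · by_cases hvi : v = i
        · subst hvi; rw [h₁.2.1, h₁'.2.1]
        · rw [← glue_mem (r := r) (p₁ := p₁) (p₂ := p₂) hv hvi, heq, glue_mem hv hvi]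
      · rw [h₁.1 v hv, h₁'.1 v hv]
    have e2 : p₂ = p₂' := by
      funext v
      by_cases hv : v ∈ B
      · rw [h₂.1 v (by simp [hv]), h₂'.1 v (by simp [hv])]
      · rw [← glue_not_mem (r := r) (p₁ := p₁) (p₂ := p₂) hi hv, heq, glue_not_mem hi hv]
    rw [e1, e2]
  · intro p hp
    obtain ⟨B, i, p₁, p₂, hB, hmB, hi, h₁, h₂, hg⟩ := tree_split (mem_trees.1 hp) hm hmr
    refine ⟨⟨⟨B, i⟩, p₁, p₂⟩, ?_, hg⟩
    simp only [Finset.mem_sigma, Finset.mem_filter, Finset.mem_powerset, Finset.mem_product,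
      mem_trees]
    exact ⟨⟨⟨hB, hmB⟩, hi⟩, h₁, h₂⟩
  · rintro ⟨⟨B, i⟩, p₁, p₂⟩ h
    simp only [Finset.mem_sigma, Finset.mem_filter, Finset.mem_powerset, Finset.mem_product,
      mem_trees] at h ⊢
    obtain ⟨⟨⟨hB, hmB⟩, hi⟩, h₁, h₂⟩ := h
    have hS : S.erase r = insert i (B.erase i) ∪ (S \ B).erase r := by
      rw [Finset.insert_erase hi]
      ext v
      simp only [Finset.mem_erase, Finset.mem_union, Finset.mem_sdiff]
      have := @hB v
      simp only [Finset.mem_erase] at this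
      tauto
    rw [hS, Finset.prod_union, Finset.prod_insert (by simp), glue_root, dsc_glue_root hi h₁ h₂]
    · congr 1
      · congr 1
        refine Finset.prod_congr rfl fun v hv => ?_
        rw [Finset.mem_erase] at hv
        rw [glue_mem hv.2 hv.1, dsc_glue_mem hB hi h₁ h₂ hv.2 hv.1]
      · refine Finset.prod_congr rfl fun v hv => ?_
        simp only [Finset.mem_erase, Finset.mem_sdiff] at hv
        rw [glue_not_mem hi hv.2.2, dsc_glue_not_mem hB hi h₁ h₂ hv.2.2 hv.1]
    · rw [Finset.insert_erase hi, Finset.disjoint_left]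
      intro v hv
      simp [hv]

lemma W_single (φ : V → V → Finset V → R) (r : V) : W φ {r} r = 1 := by
  have : trees {r} r = {(id : V → V)} := by
    ext p
    rw [mem_trees, Finset.mem_singleton]
    constructor
    · intro h
      funext v
      by_cases hv : v = r
      · subst hv; exact h.2.1
      · exact h.1 v (by simpa using hv)
    · rintro rfl
      exact ⟨fun _ _ => rfl, rfl, fun _ h => h, fun v hv => ⟨0, by simpa using hv⟩⟩
  simp [W, this]

end TreeDecomp

section ConnAlg

variable {V : Type*} [DecidableEq V] {R : Type*} [CommRing R]

lemma swap_sum (C E : Finset V → R) (g : Finset V → R) (S : Finset V) (r s : V) :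
    ∑ B ∈ S.powerset.filter (fun B => r ∈ B ∧ s ∉ B), g B *
      ∑ D ∈ (S \ B).powerset.filter (s ∈ ·), C D * E ((S \ B) \ D) =
    ∑ D ∈ S.powerset.filter (fun B => s ∈ B ∧ r ∉ B), C D *
      ∑ B ∈ (S \ D).powerset.filter (r ∈ ·), g B * E ((S \ D) \ B) := by
  simp_rw [Finset.mul_sum]
  rw [Finset.sum_comm' (t' := S.powerset.filter (fun B => s ∈ B ∧ r ∉ B))
    (s' := fun D => (S \ D).powerset.filter (r ∈ ·))]
  · refine Finset.sum_congr rfl fun D _ => Finset.sum_congr rfl fun B _ => ?_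
    rw [sdiff_right_comm]; ring
  · intro B D
    simp only [Finset.mem_filter, Finset.mem_powerset, Finset.subset_sdiff]
    constructor
    · rintro ⟨⟨h1, h2, h3⟩, ⟨h4, h5⟩, h6⟩
      exact ⟨⟨⟨h1, h5.symm⟩, h2⟩, h4, h6, Finset.disjoint_left.1 h5.symm h2⟩
    · rintro ⟨⟨⟨h1, h2⟩, h3⟩, h4, h5, h6⟩
      exact ⟨⟨h1, h3, Finset.disjoint_left.1 h2.symm h5⟩, ⟨h4, h2.symm⟩, h5⟩

lemma split_sum (f : Finset V → R) (S : Finset V) (r s : V) :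
    ∑ B ∈ S.powerset.filter (r ∈ ·), f B =
    ∑ B ∈ S.powerset.filter (fun B => r ∈ B ∧ s ∈ B), f B +
    ∑ B ∈ S.powerset.filter (fun B => r ∈ B ∧ s ∉ B), f B := by
  rw [← Finset.sum_filter_add_sum_filter_not _ (s ∈ ·), Finset.filter_filter,
    Finset.filter_filter]

open Classical in
noncomputable def CC (E : Finset V → R) : Finset V → R :=
  Finset.strongInduction fun S ih =>
    if h : S.Nonempty then
      E S - ∑ B ∈ S.ssubsets.attach, if h.choose ∈ B.1 then
        ih B.1 (Finset.mem_ssubsets.1 B.2) * E (S \ B.1) else 0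
    else 0

lemma CC_choose (E : Finset V → R) (h0 : E ∅ = 1) (S : Finset V) (h : S.Nonempty) :
    E S = ∑ B ∈ S.powerset.filter (h.choose ∈ ·), CC E B * E (S \ B) := by
  have h1 : CC E S = E S - ∑ B ∈ S.ssubsets.filter (h.choose ∈ ·), CC E B * E (S \ B) := by
    rw [CC, Finset.strongInduction_eq, dif_pos h, Finset.sum_filter]
    congr 1
    rw [← Finset.sum_attach S.ssubsets]
  have h2 : S.powerset.filter (h.choose ∈ ·) =
      insert S (S.ssubsets.filter (h.choose ∈ ·)) := by
    ext B
    simp only [Finset.mem_filter, Finset.mem_powerset, Finset.mem_insert, Finset.mem_ssubsets]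
    constructor
    · rintro ⟨h1, h2⟩
      rcases h1.eq_or_ssubset with h | h'
      · exact Or.inl h
      · exact Or.inr ⟨h', h2⟩
    · rintro (rfl | ⟨h1, h2⟩)
      · exact ⟨subset_rfl, h.choose_spec⟩
      · exact ⟨h1.1, h2⟩
  rw [h2, Finset.sum_insert (by simp), h1]
  simp [h0]

lemma CC_spec (E : Finset V → R) (h0 : E ∅ = 1) (S : Finset V) :
    ∀ r ∈ S, E S = ∑ B ∈ S.powerset.filter (r ∈ ·), CC E B * E (S \ B) := by
  induction S using Finset.strongInduction with
  | H S ih =>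
    intro r hr
    have hS : S.Nonempty := ⟨r, hr⟩
    have hc := CC_choose E h0 S hS
    have hsm := hS.choose_spec
    generalize hS.choose = s at *
    rw [hc, split_sum _ S s r, split_sum _ S r s]
    have aux : ∀ a b : V, a ∈ S → b ∈ S →
        ∑ B ∈ S.powerset.filter (fun B => a ∈ B ∧ b ∉ B), CC E B * E (S \ B) =
        ∑ B ∈ S.powerset.filter (fun B => a ∈ B ∧ b ∉ B), CC E B *
          ∑ D ∈ (S \ B).powerset.filter (b ∈ ·), CC E D * E ((S \ B) \ D) := by
      intro a b ha hb
      refine Finset.sum_congr rfl fun B hB => ?_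
      simp only [Finset.mem_filter, Finset.mem_powerset] at hB
      rw [← ih (S \ B) (Finset.sdiff_ssubset hB.1 ⟨a, hB.2.1⟩) b (by simp [hb, hB.2.2])]
    rw [aux s r hsm hr, aux r s hr hsm, swap_sum]
    congr 1
    refine Finset.sum_congr ?_ fun _ _ => rfl
    ext B; simp; tauto

lemma CC_rec (E : Finset V → R) (h0 : E ∅ = 1) (w : V → Finset V → R)
    (hE : ∀ r S, r ∉ S → E (insert r S) = w r S * E S)
    (hw : ∀ r A B, Disjoint A B → w r (A ∪ B) = w r A * w r B) (S : Finset V) :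
    ∀ r s, r ∈ S → s ∈ S → s ≠ r → CC E S =
      ∑ B ∈ (S.erase r).powerset.filter (s ∈ ·), (w r B - 1) * CC E B * CC E (S \ B) := by
  induction S using Finset.strongInduction with
  | H S ih =>
    intro r s hr hs hsr
    have hset : (S.erase r).powerset.filter (s ∈ ·) =
        S.powerset.filter (fun B => s ∈ B ∧ r ∉ B) := by
      ext B
      simp only [Finset.mem_filter, Finset.mem_powerset, Finset.subset_erase]
      tauto
    have e1 : E S = ∑ B ∈ S.powerset.filter (fun B => s ∈ B ∧ r ∉ B), w r B * CC E B *
        ∑ D ∈ (S \ B).powerset.filter (r ∈ ·), CC E D * E ((S \ B) \ D) := by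
      conv_lhs => rw [← Finset.insert_erase hr]
      rw [hE _ _ (by simp), CC_spec E h0 (S.erase r) s (by simp [hs, hsr]), hset, Finset.mul_sum]
      refine Finset.sum_congr rfl fun B hB => ?_
      simp only [Finset.mem_filter, Finset.mem_powerset] at hB
      rw [← CC_spec E h0 (S \ B) r (by simp [hr, hB.2.2])]
      have hBr : B ⊆ S.erase r := Finset.subset_erase.2 ⟨hB.1, hB.2.2⟩
      have h1 : w r (S.erase r) = w r B * w r (S.erase r \ B) := by
        rw [← hw _ _ _ Finset.disjoint_sdiff, Finset.union_sdiff_of_subset hBr]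
      have h2 : S \ B = insert r (S.erase r \ B) := by
        ext v
        simp only [Finset.mem_sdiff, Finset.mem_insert, Finset.mem_erase]
        by_cases hv : v = r
        · subst hv; simp [hr, hB.2.2]
        · simp [hv]
      rw [h2, hE _ _ (by simp), h1]; ring
    have e2 : E S = ∑ F ∈ S.powerset.filter (fun B => r ∈ B ∧ s ∈ B), CC E F * E (S \ F) +
        ∑ B ∈ S.powerset.filter (fun B => s ∈ B ∧ r ∉ B), CC E B *
        ∑ D ∈ (S \ B).powerset.filter (r ∈ ·), CC E D * E ((S \ B) \ D) := by
      rw [CC_spec E h0 S r hr, split_sum _ S r s, ← swap_sum]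
      congr 1
      refine Finset.sum_congr rfl fun B hB => ?_
      simp only [Finset.mem_filter, Finset.mem_powerset] at hB
      rw [← CC_spec E h0 (S \ B) s (by simp [hs, hB.2.2])]
    have e3 : ∑ F ∈ S.powerset.filter (fun B => r ∈ B ∧ s ∈ B), CC E F * E (S \ F) =
        ∑ B ∈ S.powerset.filter (fun B => s ∈ B ∧ r ∉ B), ((w r B - 1) * CC E B *
        ∑ D ∈ (S \ B).powerset.filter (r ∈ ·), CC E D * E ((S \ B) \ D)) := by
      rw [e1] at e2
      rw [← sub_eq_iff_eq_add, ← Finset.sum_sub_distrib] at e2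
      rw [← e2]
      refine Finset.sum_congr rfl fun B _ => ?_
      ring
    have e4 : ∑ F ∈ S.powerset.filter (fun B => r ∈ B ∧ s ∈ B),
        (∑ B ∈ (F.erase r).powerset.filter (s ∈ ·), (w r B - 1) * CC E B * CC E (F \ B)) *
          E (S \ F) =
        ∑ B ∈ S.powerset.filter (fun B => s ∈ B ∧ r ∉ B), ((w r B - 1) * CC E B *
        ∑ D ∈ (S \ B).powerset.filter (r ∈ ·), CC E D * E ((S \ B) \ D)) := by
      simp_rw [Finset.sum_mul, Finset.mul_sum]
      rw [Finset.sum_sigma', Finset.sum_sigma']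
      refine Finset.sum_bij' (fun x _ => ⟨x.2, x.1 \ x.2⟩) (fun x _ => ⟨x.1 ∪ x.2, x.1⟩)
        ?_ ?_ ?_ ?_ ?_
      · rintro ⟨F, B⟩ h
        simp only [Finset.mem_sigma, Finset.mem_filter, Finset.mem_powerset,
          Finset.subset_erase] at h ⊢
        obtain ⟨⟨h1, h2, h3⟩, ⟨h4, h5⟩, h6⟩ := h
        exact ⟨⟨h4.trans h1, h6, h5⟩, Finset.sdiff_subset_sdiff h1 subset_rfl, by simp [h2, h5]⟩
      · rintro ⟨B, D⟩ h
        simp only [Finset.mem_sigma, Finset.mem_filter, Finset.mem_powerset,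
          Finset.subset_erase, Finset.subset_sdiff] at h ⊢
        obtain ⟨⟨h1, h2, h3⟩, ⟨h4, h5⟩, h6⟩ := h
        exact ⟨⟨Finset.union_subset h1 h4, by simp [h6], by simp [h2]⟩,
          ⟨Finset.subset_union_left, h3⟩, h2⟩
      · rintro ⟨F, B⟩ h
        simp only [Finset.mem_sigma, Finset.mem_filter, Finset.mem_powerset,
          Finset.subset_erase] at h
        simp [Finset.union_sdiff_of_subset h.2.1.1]
      · rintro ⟨B, D⟩ h
        simp only [Finset.mem_sigma, Finset.mem_filter, Finset.mem_powerset,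
          Finset.subset_sdiff] at h
        simp [Finset.union_sdiff_cancel_left h.2.1.2.symm]
      · rintro ⟨F, B⟩ h
        simp only [Finset.mem_sigma, Finset.mem_filter, Finset.mem_powerset,
          Finset.subset_erase] at h
        have : (S \ B) \ (F \ B) = S \ F := by
          rw [sdiff_sdiff_left]
          congr 1
          exact Finset.union_sdiff_of_subset h.2.1.1
        simp only [this]; ring
    rw [← e4, ← sub_eq_zero, ← Finset.sum_sub_distrib] at e3
    rw [Finset.sum_eq_single S] at e3
    · simp only [sdiff_self, Finset.bot_eq_empty, h0, mul_one] at e3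
      exact sub_eq_zero.1 e3
    · intro F hF hFS
      simp only [Finset.mem_filter, Finset.mem_powerset] at hF
      rw [← ih F (lt_of_le_of_ne hF.1 hFS) r s hF.2.1 hF.2.2 hsr, sub_self]
    · intro h
      simp [hr, hs] at h

end ConnAlg

end ThresholdFlow

namespace ThresholdFlow

section GraphPart

open Classical in
noncomputable def eN {n : ℕ} (G : SimpleGraph (Fin (n+1))) (r : Fin (n+1))
    (B : Finset (Fin (n+1))) : ℕ := (B.filter (fun j => G.Adj r j)).card

open Classical in
noncomputable def EE {n : ℕ} (G : SimpleGraph (Fin (n+1))) (S : Finset (Fin (n+1))) :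
    Polynomial ℤ := ∏ i ∈ S, ∏ j ∈ S, if j < i ∧ G.Adj i j then X else 1

open Classical in
noncomputable def phi {n : ℕ} (G : SimpleGraph (Fin (n+1))) (i j : Fin (n+1))
    (D : Finset (Fin (n+1))) : Polynomial ℤ :=
  if G.Adj i j then X ^ (D.filter (· < i)).card else 0

open Classical in
noncomputable def psi {n : ℕ} (G : SimpleGraph (Fin (n+1))) (i j : Fin (n+1))
    (D : Finset (Fin (n+1))) : Polynomial ℤ :=
  if j < i ∧ G.Adj i j then qnat D.card else 0

variable {n : ℕ} {G : SimpleGraph (Fin (n+1))}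

lemma EE_insert (r : Fin (n+1)) (S : Finset (Fin (n+1))) (hr : r ∉ S) :
    EE G (insert r S) = X ^ eN G r S * EE G S := by
  classical
  have h1 : ∀ T : Finset (Fin (n+1)), ∀ i, (∏ j ∈ insert r S, if j < i ∧ G.Adj i j then
      (X : Polynomial ℤ) else 1) = (if r < i ∧ G.Adj i r then X else 1) *
      ∏ j ∈ S, if j < i ∧ G.Adj i j then X else 1 := by
    intro _ i
    rw [Finset.prod_insert hr]
  have h2 : (X : Polynomial ℤ) ^ eN G r S = (∏ j ∈ S, if j < r ∧ G.Adj r j then X else 1) *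
      ∏ i ∈ S, if r < i ∧ G.Adj i r then X else 1 := by
    rw [← Finset.prod_mul_distrib, eN, ← Finset.prod_const, Finset.prod_filter]
    refine Finset.prod_congr rfl fun j hj => ?_
    have hjr : j ≠ r := fun h => hr (h ▸ hj)
    by_cases ha : G.Adj r j
    · rcases lt_or_gt_of_ne hjr with h | h
      · simp [ha, h, h.not_gt]
      · simp [ha, h, h.not_gt, ha.symm]
    · have : ¬ G.Adj j r := fun h => ha h.symm
      simp [ha, this]
  rw [EE, Finset.prod_insert hr, Finset.prod_congr rfl (fun i _ => h1 S i),
    Finset.prod_mul_distrib, h1 S, h2, EE]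
  simp
  ring

lemma eN_union (r : Fin (n+1)) (A B : Finset (Fin (n+1))) (h : Disjoint A B) :
    (X : Polynomial ℤ) ^ eN G r (A ∪ B) = X ^ eN G r A * X ^ eN G r B := by
  classical
  rw [← pow_add, eN, eN, eN, Finset.filter_union,
    Finset.card_union_of_disjoint (Finset.disjoint_filter_filter h)]

lemma sum_rank (N : Finset (Fin (n+1))) :
    ∑ i ∈ N, (X : Polynomial ℤ) ^ (N.filter (· < i)).card = qnat N.card := by
  induction N using Finset.induction_on_max with
  | empty => simp [qnat]
  | insert a s h ih =>
    have ha : a ∉ s := fun h' => lt_irrefl _ (h a h')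
    rw [Finset.sum_insert ha, Finset.card_insert_of_notMem ha, qnat, Finset.sum_range_succ,
      ← qnat, ← ih, add_comm]
    congr 1
    · refine Finset.sum_congr rfl fun i hi => ?_
      rw [Finset.filter_insert, if_neg (h i hi).not_gt]
    · rw [Finset.filter_insert, if_neg (lt_irrefl _), Finset.filter_true_of_mem h]

lemma adj_lower (hG : IsThreshold n G) {r i j : Fin (n+1)} (h : G.Adj r i) (hji : j ≤ i)
    (hjr : j ≠ r) : G.Adj r j := by
  rcases lt_or_gt_of_ne h.ne with h' | h'
  · exact (hG i r j r h' h.symm hji le_rfl hjr).symm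
  · exact hG r i r j h' h le_rfl hji hjr.symm

lemma sum_phi (hG : IsThreshold n G) (r : Fin (n+1)) (B : Finset (Fin (n+1))) (hr : r ∉ B) :
    ∑ i ∈ B, phi G i r B = qnat (eN G r B) := by
  classical
  rw [eN, ← sum_rank, Finset.sum_filter]
  refine Finset.sum_congr rfl fun i hi => ?_
  rw [phi]
  by_cases ha : G.Adj r i
  · rw [if_pos ha, if_pos ha.symm, Finset.filter_filter]
    congr 2
    refine Finset.filter_congr fun j hj => ?_
    constructor
    · intro h
      exact ⟨adj_lower hG ha h.le (fun h' => hr (h' ▸ hj)), h⟩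
    · exact fun h => h.2
  · rw [if_neg ha, if_neg (fun h => ha h.symm)]

lemma qnat_mul (k : ℕ) : qnat k * (X - 1) = X ^ k - 1 := geom_sum_mul _ _

lemma W_phi_CC (hG : IsThreshold n G) (S : Finset (Fin (n+1))) :
    ∀ r ∈ S, (X - 1) ^ (S.card - 1) * W (phi G) S r = CC (EE G) S := by
  induction S using Finset.strongInduction with
  | H S ih =>
    intro r hr
    have h0 : EE G ∅ = 1 := by simp [EE]
    by_cases hS : S = {r}
    · subst hS
      have := CC_spec (EE G) h0 {r} r hr
      have hf : (({r} : Finset (Fin (n+1))).powerset.filter (r ∈ ·)) = {{r}} := by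
        ext B
        simp only [Finset.mem_filter, Finset.mem_powerset, Finset.subset_singleton_iff,
          Finset.mem_singleton]
        constructor
        · rintro ⟨rfl | rfl, h⟩
          · simp at h
          · rfl
        · rintro rfl; simp
      rw [hf] at this
      simp [h0] at this
      rw [W_single, ← this]
      simp [EE]
    · obtain ⟨m, hm, hmr⟩ : ∃ m ∈ S, m ≠ r := by
        by_contra h
        push Not at h
        exact hS (Finset.eq_singleton_iff_unique_mem.2 ⟨hr, h⟩)
      rw [W_rec _ S r m hr hm hmr, CC_rec (EE G) h0 (fun r B => X ^ eN G r B)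
        (fun r S h => EE_insert r S h) (fun r A B h => eN_union r A B h) S r m hr hm hmr,
        Finset.mul_sum]
      refine Finset.sum_congr rfl fun B hB => ?_
      simp only [Finset.mem_filter, Finset.mem_powerset, Finset.subset_erase] at hB
      obtain ⟨⟨hBS, hrB⟩, hmB⟩ := hB
      have hlt : B ⊂ S := ⟨hBS, fun h => hrB (h hr)⟩
      have hlt' : S \ B ⊂ S := Finset.sdiff_ssubset hBS ⟨m, hmB⟩
      rw [← ih _ hlt' r (by simp [hr, hrB]), ← qnat_mul, ← sum_phi hG r B hrB]
      have hc : S.card - 1 = (B.card - 1) + ((S \ B).card - 1) + 1 := by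
        have h1 := Finset.card_sdiff_add_card_eq_card hBS
        have h2 : 0 < B.card := Finset.card_pos.2 ⟨m, hmB⟩
        have h3 : 0 < (S \ B).card := Finset.card_pos.2 ⟨r, by simp [hr, hrB]⟩
        omega
      rw [Finset.mul_sum, Finset.sum_mul, Finset.sum_mul, Finset.sum_mul, hc]
      refine Finset.sum_congr rfl fun i hi => ?_
      rw [← ih _ hlt i hi]
      ring

lemma W_phi_root (hG : IsThreshold n G) (S : Finset (Fin (n+1))) (r s : Fin (n+1)) (hr : r ∈ S)
    (hs : s ∈ S) : W (phi G) S r = W (phi G) S s := by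
  have h : (X - 1 : Polynomial ℤ) ^ (S.card - 1) ≠ 0 :=
    pow_ne_zero _ (by simpa using Polynomial.X_sub_C_ne_zero (1 : ℤ))
  apply mul_left_cancel₀ h
  rw [W_phi_CC hG S r hr, W_phi_CC hG S s hs]

lemma W_phi_isolated (S : Finset (Fin (n+1))) (b m : Fin (n+1)) (hb : b ∈ S) (hm : m ∈ S)
    (hmb : m ≠ b) (h : ∀ c ∈ S, ¬ G.Adj c b) : W (phi G) S b = 0 := by
  rw [W_rec _ S b m hb hm hmb]
  refine Finset.sum_eq_zero fun B hB => Finset.sum_eq_zero fun i hi => ?_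
  simp only [Finset.mem_filter, Finset.mem_powerset, Finset.subset_erase] at hB
  rw [phi, if_neg (h i (hB.1.1 hi))]; ring

lemma W_psi_zero (S : Finset (Fin (n+1))) :
    ∀ r m, r ∈ S → m ∈ S → m < r → W (psi G) S r = 0 := by
  induction S using Finset.strongInduction with
  | H S ih =>
    intro r m hr hm hmr
    rw [W_rec _ S r m hr hm hmr.ne]
    refine Finset.sum_eq_zero fun B hB => Finset.sum_eq_zero fun i hi => ?_
    simp only [Finset.mem_filter, Finset.mem_powerset, Finset.subset_erase] at hB
    rw [psi]
    split_ifs with h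
    · rw [ih B ⟨hB.1.1, fun h => hB.1.2 (h hr)⟩ i m hi hB.2 (hmr.trans h.1)]; ring
    · ring

lemma W_psi_eq (hG : IsThreshold n G) (S : Finset (Fin (n+1))) :
    ∀ r ∈ S, (∀ v ∈ S, r ≤ v) → W (psi G) S r = W (phi G) S r := by
  classical
  induction S using Finset.strongInduction with
  | H S ih =>
    intro r hr hmin
    by_cases hS : S = {r}
    · subst hS; rw [W_single, W_single]
    obtain ⟨m, hm, hmr⟩ : ∃ m ∈ S, m ≠ r := by
      by_contra h
      push Not at h
      exact hS (Finset.eq_singleton_iff_unique_mem.2 ⟨hr, h⟩)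
    rw [W_rec _ S r m hr hm hmr, W_rec _ S r m hr hm hmr]
    refine Finset.sum_congr rfl fun B hB => ?_
    simp only [Finset.mem_filter, Finset.mem_powerset, Finset.subset_erase] at hB
    obtain ⟨⟨hBS, hrB⟩, hmB⟩ := hB
    have hlt : B ⊂ S := ⟨hBS, fun h => hrB (h hr)⟩
    have hlt' : S \ B ⊂ S := Finset.sdiff_ssubset hBS ⟨m, hmB⟩
    rw [← Finset.sum_mul, ← Finset.sum_mul, ih _ hlt' r (by simp [hr, hrB])
      (fun v hv => hmin v (Finset.mem_sdiff.1 hv).1)]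
    congr 1
    have hBne : B.Nonempty := ⟨m, hmB⟩
    obtain ⟨u, hu, humin⟩ : ∃ u ∈ B, ∀ v ∈ B, u ≤ v :=
      ⟨B.min' hBne, B.min'_mem hBne, fun v hv => B.min'_le v hv⟩
    have hru : r < u := lt_of_le_of_ne (hmin u (hBS hu)) (fun h => hrB (h ▸ hu))
    have hL : ∑ i ∈ B, psi G i r B * W (psi G) B i = psi G u r B * W (phi G) B u := by
      rw [Finset.sum_eq_single_of_mem u hu, ih B hlt u hu humin]
      intro i hi hiu
      rw [W_psi_zero B i u hi hu (lt_of_le_of_ne (humin i hi) hiu.symm), mul_zero]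
    have hR : ∑ i ∈ B, phi G i r B * W (phi G) B i = qnat (eN G r B) * W (phi G) B u := by
      rw [← sum_phi hG r B hrB, Finset.sum_mul]
      refine Finset.sum_congr rfl fun i hi => ?_
      rw [W_phi_root hG B i u hi hu]
    rw [hL, hR, psi]
    by_cases hau : G.Adj r u
    · rw [if_pos ⟨hru, hau.symm⟩]
      by_cases hall : ∀ b ∈ B, G.Adj r b
      · rw [eN, Finset.filter_true_of_mem hall]
      · push Not at hall
        obtain ⟨b, hb, hnb⟩ := hall
        have hub : u ≠ b := by rintro rfl; exact hnb hau
        rw [W_phi_root hG B u b hu hb, W_phi_isolated B b u hb hu hub, mul_zero, mul_zero]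
        intro c hc hcb
        refine hnb (adj_lower hG hcb.symm (hmin c (hBS hc)) ?_).symm
        rintro rfl; exact hrB hb
    · rw [if_neg (fun h => hau h.2.symm)]
      have : eN G r B = 0 := by
        rw [eN, Finset.card_eq_zero, Finset.filter_eq_empty_iff]
        intro i hi hri
        exact hau (adj_lower hG hri (humin i hi) hru.ne')
      rw [this]; simp [qnat]

end GraphPart

end ThresholdFlow

namespace ThresholdFlow

section FlowPart

variable {n : ℕ} {G : SimpleGraph (Fin (n+1))}

lemma trees_side : ∑ᶠ p ∈ {p | IsSpanTree n G p}, (X : Polynomial ℤ) ^ treeInv n p =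
    W (phi G) Finset.univ 0 := by
  classical
  have hset : {p | IsSpanTree n G p} = ((trees (Finset.univ : Finset (Fin (n+1))) 0).filter
      (fun p => ∀ i, i ≠ 0 → G.Adj i (p i)) : Set (Fin (n+1) → Fin (n+1))) := by
    ext p
    simp only [Set.mem_ofPred_eq, Finset.coe_filter, mem_trees, IsTreeOn, IsSpanTree]
    simp
    tauto
  rw [hset, finsum_mem_coe_finset, W, Finset.sum_filter]
  refine Finset.sum_congr rfl fun p _ => ?_
  split_ifs with h
  · have h1 : ∀ i ∈ Finset.univ.erase (0 : Fin (n+1)), phi G i (p i) (dsc p i) =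
        X ^ ((dsc p i).filter (· < i)).card := by
      intro i hi
      rw [phi, if_pos (h i (Finset.ne_of_mem_erase hi))]
    rw [Finset.prod_congr rfl h1, Finset.prod_pow_eq_pow_sum]
    congr 1
    have : invSet n p = (((Finset.univ.erase (0 : Fin (n+1))).sigma
        (fun i => (dsc p i).filter (· < i))).image (fun x => (x.1, x.2)) : Finset _) := by
      ext ⟨i, j⟩
      simp only [invSet, Desc, Set.mem_ofPred_eq, Finset.coe_image, Set.mem_image,
        Finset.mem_coe, Finset.mem_sigma, Finset.mem_filter, mem_dsc, Finset.mem_erase]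
      constructor
      · rintro ⟨h1, h2, h3⟩
        exact ⟨⟨i, j⟩, ⟨⟨h2, Finset.mem_univ _⟩, h3, h1⟩, rfl⟩
      · rintro ⟨⟨a, b⟩, ⟨⟨h2, _⟩, h3, h1⟩, h4⟩
        simp only [Prod.mk.injEq] at h4
        obtain ⟨rfl, rfl⟩ := h4
        exact ⟨h1, h2, h3⟩
    rw [treeInv, this, Set.ncard_coe_finset, Finset.card_image_of_injective, Finset.card_sigma]
    rintro ⟨a, b⟩ ⟨c, d⟩ h
    simp only [Prod.mk.injEq] at h
    obtain ⟨rfl, rfl⟩ := h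
    rfl
  · push Not at h
    obtain ⟨i, hi, hadj⟩ := h
    symm
    exact Finset.prod_eq_zero (i := i) (by simp [hi]) (by rw [phi, if_neg hadj])

/-- Increasing spanning trees. -/
def IncT (n : ℕ) (G : SimpleGraph (Fin (n+1))) (p : Fin (n+1) → Fin (n+1)) : Prop :=
  p 0 = 0 ∧ ∀ i, i ≠ 0 → p i < i ∧ G.Adj i (p i)

lemma IncT.reach {p : Fin (n+1) → Fin (n+1)} (h : IncT n G p) (i : Fin (n+1)) :
    ∃ k, p^[k] i = 0 := by
  induction i using WellFoundedLT.induction with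
  | ind i ih =>
    by_cases hi : i = 0
    · exact ⟨0, hi⟩
    · obtain ⟨k, hk⟩ := ih (p i) (h.2 i hi).1
      exact ⟨k + 1, by rw [Function.iterate_succ_apply, hk]⟩

lemma IncT.le {p : Fin (n+1) → Fin (n+1)} (h : IncT n G p) (i : Fin (n+1)) : p i ≤ i := by
  by_cases hi : i = 0
  · rw [hi, h.1]
  · exact (h.2 i hi).1.le

lemma IncT.iter_le {p : Fin (n+1) → Fin (n+1)} (h : IncT n G p) (k : ℕ) (i : Fin (n+1)) :
    p^[k] i ≤ i :=
  iter_inv p (· ≤ i) (fun v hv => (h.le v).trans hv) k i le_rfl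

lemma IncT.dsc_card {p : Fin (n+1) → Fin (n+1)} (h : IncT n G p) (i : Fin (n+1)) (hi : i ≠ 0) :
    (dsc p i).card = 1 + ∑ c ∈ Finset.univ.filter (fun c => c ≠ 0 ∧ p c = i), (dsc p c).card := by
  have h1 : dsc p i = insert i ((Finset.univ.filter (fun c => c ≠ 0 ∧ p c = i)).biUnion
      (dsc p)) := by
    ext j
    simp only [Finset.mem_insert, Finset.mem_biUnion, Finset.mem_filter, Finset.mem_univ,
      true_and, mem_dsc]
    constructor
    · rintro ⟨k, hk⟩
      cases k with
      | zero => exact Or.inl hk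
      | succ k =>
        rw [Function.iterate_succ_apply'] at hk
        refine Or.inr ⟨p^[k] j, ⟨?_, hk⟩, k, rfl⟩
        intro h0
        rw [h0, h.1] at hk
        exact hi hk.symm
    · rintro (rfl | ⟨c, ⟨_, hc⟩, k, hk⟩)
      · exact ⟨0, rfl⟩
      · exact ⟨k + 1, by rw [Function.iterate_succ_apply', hk, hc]⟩
  rw [h1, Finset.card_insert_of_notMem, Finset.card_biUnion, add_comm]
  · intro c hc c' hc' hne
    replace hc := (Finset.mem_filter.1 hc).2
    replace hc' := (Finset.mem_filter.1 hc').2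
    rw [Function.onFun, Finset.disjoint_left]
    intro j hj hj'
    obtain ⟨k, hk⟩ := mem_dsc.1 hj
    obtain ⟨l, hl⟩ := mem_dsc.1 hj'
    have key : ∀ (a b : Fin (n+1)) (k l : ℕ), p a = i → b ≠ 0 → p b = i → p^[k] j = a →
        p^[l] j = b → ¬ k < l := by
      intro a b k l ha hb hb' hka hlb hlt
      obtain ⟨d, rfl⟩ := Nat.exists_eq_add_of_lt hlt
      rw [show k + d + 1 = d + (k + 1) by ring, Function.iterate_add_apply,
        Function.iterate_succ_apply', hka, ha] at hlb
      have h2 := h.iter_le d i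
      rw [hlb] at h2
      have h3 := (h.2 b hb).1
      rw [hb'] at h3
      exact absurd h3 (not_lt.2 h2)
    have a1 := key c c' k l hc.2 hc'.1 hc'.2 hk hl
    have a2 := key c' c l k hc'.2 hc.1 hc.2 hl hk
    have : k = l := by omega
    exact hne (by rw [← hk, ← hl, this])
  · simp only [Finset.mem_biUnion, Finset.mem_filter, Finset.mem_univ, true_and, mem_dsc,
      not_exists, not_and]
    rintro c ⟨hc0, hc⟩ k hk
    have h2 := h.iter_le k i
    rw [hk] at h2
    have h3 := (h.2 c hc0).1
    rw [hc] at h3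
    exact absurd h3 (not_lt.2 h2)

lemma dsc_pos (p : Fin (n+1) → Fin (n+1)) (i : Fin (n+1)) : 0 < (dsc p i).card :=
  Finset.card_pos.2 ⟨i, mem_dsc.2 ⟨0, rfl⟩⟩

/-- The flow of a tree. -/
noncomputable def flowOf (p : Fin (n+1) → Fin (n+1)) : Fin (n+1) → Fin (n+1) → ℕ :=
  fun i j => if i ≠ 0 ∧ p i = j then (dsc p i).card else 0

lemma flowOf_pos (p : Fin (n+1) → Fin (n+1)) (i j : Fin (n+1)) :
    0 < flowOf p i j ↔ i ≠ 0 ∧ p i = j := by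
  rw [flowOf]
  split_ifs with h
  · exact iff_of_true (dsc_pos p i) h
  · simp only [lt_irrefl, false_iff]; exact h

lemma flowOf_row (p : Fin (n+1) → Fin (n+1)) (i : Fin (n+1)) (hi : i ≠ 0) :
    ∑ j, flowOf p i j = (dsc p i).card := by
  simp [flowOf, hi]

lemma flowOf_col (p : Fin (n+1) → Fin (n+1)) (i : Fin (n+1)) :
    ∑ j, flowOf p j i =
      ∑ c ∈ Finset.univ.filter (fun c => c ≠ 0 ∧ p c = i), (dsc p c).card := by
  rw [Finset.sum_filter]; rfl

lemma flowOf_mapsTo {p : Fin (n+1) → Fin (n+1)} (h : IncT n G p) :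
    IsFlow n G (fun _ => 1) (flowOf p) ∧ posCount n (flowOf p) = n := by
  refine ⟨⟨?_, ?_⟩, ?_⟩
  · intro i j hij
    obtain ⟨h0, rfl⟩ := (flowOf_pos p i j).1 (Nat.pos_of_ne_zero hij)
    exact h.2 i h0
  · intro i hi
    rw [flowOf_row p i hi, flowOf_col, h.dsc_card i hi]
  · rw [posCount]
    have : (Finset.univ.filter fun pr : Fin (n+1) × Fin (n+1) => 0 < flowOf p pr.1 pr.2) =
        (Finset.univ.erase (0 : Fin (n+1))).image (fun i => (i, p i)) := by
      ext ⟨i, j⟩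
      simp only [Finset.mem_filter, Finset.mem_univ, true_and, flowOf_pos, Finset.mem_image,
        Finset.mem_erase, Prod.mk.injEq, and_true]
      constructor
      · rintro ⟨h1, h2⟩; exact ⟨i, h1, rfl, h2⟩
      · rintro ⟨a, h1, rfl, h2⟩; exact ⟨h1, h2⟩
    rw [this, Finset.card_image_of_injective]
    · simp
    · intro a b hab
      exact (Prod.mk.inj hab).1

lemma flow_unique {f : Fin (n+1) → Fin (n+1) → ℕ} (hf : IsFlow n G (fun _ => 1) f)
    (hc : posCount n f = n) : ∃ p, IncT n G p ∧ flowOf p = f := by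
  classical
  have hrow : ∀ i : Fin (n+1), i ≠ 0 → ∃ j, 0 < f i j := by
    intro i hi
    have hsum : ∑ j, f i j = 1 + ∑ j, f j i := hf.2 i hi
    by_contra hno
    push Not at hno
    have : ∑ j, f i j = 0 := Finset.sum_eq_zero fun j _ => Nat.le_zero.1 (hno j)
    omega
  have hz : ∀ j, f 0 j = 0 := by
    intro j
    by_contra h
    exact absurd (hf.1 0 j h).1 (by simp)
  let p : Fin (n+1) → Fin (n+1) := fun i => if h : i ≠ 0 then (hrow i h).choose else 0
  have hp0 : p 0 = 0 := by simp [p]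
  have hp : ∀ i, i ≠ 0 → 0 < f i (p i) := by
    intro i hi
    simp only [p, dif_pos hi]
    exact (hrow i hi).choose_spec
  have hset : (Finset.univ.erase (0 : Fin (n+1))).image (fun i => (i, p i)) =
      (Finset.univ.filter fun pr : Fin (n+1) × Fin (n+1) => 0 < f pr.1 pr.2) := by
    apply Finset.eq_of_subset_of_card_le
    · intro x hx
      simp only [Finset.mem_image, Finset.mem_erase, Finset.mem_univ, and_true] at hx
      obtain ⟨i, hi, rfl⟩ := hx
      simpa using hp i hi
    · rw [Finset.card_image_of_injective _ (fun a b hab => (Prod.mk.inj hab).1)]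
      change posCount n f ≤ _
      rw [hc]; simp
  have hpos : ∀ i j, 0 < f i j → p i = j := by
    intro i j hij
    have : (i, j) ∈ (Finset.univ.erase (0 : Fin (n+1))).image (fun i => (i, p i)) := by
      rw [hset]; simpa using hij
    simp only [Finset.mem_image, Prod.mk.injEq] at this
    obtain ⟨a, _, rfl, h⟩ := this
    exact h
  have hI : IncT n G p := ⟨hp0, fun i hi => hf.1 i (p i) (hp i hi).ne'⟩
  have hff : ∀ i j, f i j = if i ≠ 0 ∧ p i = j then f i (p i) else 0 := by
    intro i j
    split_ifs with h
    · rw [h.2]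
    · by_contra hne
      have h1 := hpos i j (Nat.pos_of_ne_zero hne)
      refine h ⟨?_, h1⟩
      rintro rfl
      exact hne (hz j)
  have hval : ∀ i, i ≠ 0 → f i (p i) = (dsc p i).card := by
    intro i
    induction i using WellFoundedGT.induction with
    | ind i ih =>
      intro hi
      have h1 := hf.2 i hi
      have h2 : ∑ j, f i j = f i (p i) := by
        rw [Finset.sum_congr rfl (fun j _ => hff i j)]; simp [hi]
      have h3 : ∑ j, f j i =
          ∑ c ∈ Finset.univ.filter (fun c => c ≠ 0 ∧ p c = i), (dsc p c).card := by
        rw [Finset.sum_congr rfl (fun j _ => hff j i), ← Finset.sum_filter]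
        refine Finset.sum_congr rfl fun c hc => ?_
        simp only [Finset.mem_filter, Finset.mem_univ, true_and] at hc
        refine ih c ?_ hc.1
        have := (hI.2 c hc.1).1
        rwa [hc.2] at this
      rw [h2, h3] at h1
      rw [h1, hI.dsc_card i hi]
  refine ⟨p, hI, ?_⟩
  funext i j
  rw [hff i j, flowOf]
  split_ifs with h
  · exact (hval i h.1).symm
  · rfl

lemma flow_weight {p : Fin (n+1) → Fin (n+1)} (h : IncT n G p) :
    (∏ i, ∏ j, if 0 < flowOf p i j then qnat (flowOf p i j) else 1) =
      ∏ i ∈ Finset.univ.erase 0, psi G i (p i) (dsc p i) := by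
  rw [← Finset.mul_prod_erase Finset.univ _ (Finset.mem_univ (0 : Fin (n+1)))]
  have h0 : (∏ j, if 0 < flowOf p 0 j then qnat (flowOf p 0 j) else 1) = 1 := by
    refine Finset.prod_eq_one fun j _ => ?_
    rw [if_neg]
    rw [flowOf_pos]; simp
  rw [h0, one_mul]
  refine Finset.prod_congr rfl fun i hi => ?_
  have hi0 := Finset.ne_of_mem_erase hi
  rw [psi, if_pos (h.2 i hi0), Finset.prod_eq_single (p i)]
  · rw [if_pos ((flowOf_pos p i _).2 ⟨hi0, rfl⟩), flowOf, if_pos ⟨hi0, rfl⟩]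
  · intro j _ hj
    rw [if_neg]
    rw [flowOf_pos]
    exact fun h => hj h.2.symm
  · simp

lemma flow_side : Ehr1 n G (fun _ => 1) = W (psi G) Finset.univ 0 := by
  classical
  have hb : Set.BijOn flowOf {p | IncT n G p}
      {f | IsFlow n G (fun _ => 1) f ∧ posCount n f = n} := by
    refine ⟨fun p hp => flowOf_mapsTo hp, ?_, fun f hf => flow_unique hf.1 hf.2⟩
    intro p hp p' hp' heq
    funext i
    by_cases hi : i = 0
    · rw [hi, hp.1, hp'.1]
    · have := (flowOf_pos p i (p i)).2 ⟨hi, rfl⟩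
      rw [heq] at this
      exact ((flowOf_pos p' i (p i)).1 this).2.symm
  rw [Ehr1, ← finsum_mem_eq_of_bijOn flowOf hb (fun p hp => (flow_weight hp).symm)]
  have hset : {p | IncT n G p} = ((trees (Finset.univ : Finset (Fin (n+1))) 0).filter
      (fun p => ∀ i, i ≠ 0 → p i < i ∧ G.Adj i (p i)) : Set (Fin (n+1) → Fin (n+1))) := by
    ext p
    simp only [Set.mem_ofPred_eq, Finset.coe_filter, mem_trees, IsTreeOn]
    constructor
    · intro h
      exact ⟨⟨by simp, h.1, by simp, fun v _ => h.reach v⟩, h.2⟩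
    · rintro ⟨h1, h2⟩
      exact ⟨h1.2.1, h2⟩
  rw [hset, finsum_mem_coe_finset, W, Finset.sum_filter]
  refine Finset.sum_congr rfl fun p _ => ?_
  split_ifs with h
  · rfl
  · push Not at h
    obtain ⟨i, hi, hi'⟩ := h
    symm
    exact Finset.prod_eq_zero (i := i) (by simp [hi]) (by rw [psi, if_neg (fun h => hi' h.1 h.2)])

end FlowPart

theorem ehr_q1_eq_sum_inv (n : ℕ) (hn : 1 ≤ n) (G : SimpleGraph (Fin (n+1)))
    (hG : IsThreshold n G) (hc : G.Connected) :
    Ehr1 n G (fun _ => 1) =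
      ∑ᶠ p ∈ {p | IsSpanTree n G p}, (X : Polynomial ℤ) ^ treeInv n p := by
  rw [flow_side, trees_side]
  exact W_psi_eq hG Finset.univ 0 (Finset.mem_univ _) (fun v _ => Fin.zero_le v)

end ThresholdFlow
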